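/- Let d, m be positive integers, let ρ' and ρ be d×d positive definite Hermitian complex matrices with Tr ρ' = Tr ρ = 1, and let Q₁,…,Q_m be d×d Hermitian matrices with current vector Δq ∈ ℝ^m given by Δq_u := Re Tr[(ρ'−ρ)Q_u] and covariance matrices V, V' defined as V_{uv} := (1/2)·Re Tr[ρ{Q_u − Re Tr(ρQ_u)·I, Q_v − Re Tr(ρQ_v)·I}] and analogously for V' with ρ'. Assume the symmetric-covariance condition V' = V and that V is positive definite, and set s := ΔqᵀV⁻¹Δq. Then D(ρ'‖ρ) ≥ F(s), where F(s) := ∫₀¹ λ·s/(1+λ(1−λ)s) dλ. -/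

import Mathlib

open Matrix MeasureTheory
open scoped ComplexOrder

/-- Matrix logarithm of a Hermitian positive definite matrix via the spectral
decomposition (continuous functional calculus); junk value `0` otherwise. -/
noncomputable def matLog {n : Type*} [Fintype n] [DecidableEq n]
    (A : Matrix n n ℂ) : Matrix n n ℂ :=
  if hA : A.IsHermitian then
    (hA.eigenvectorUnitary : Matrix n n ℂ) *
      Matrix.diagonal (fun i => (Real.log (hA.eigenvalues i) : ℂ)) *
      (star (hA.eigenvectorUnitary : Matrix n n ℂ))
  else 0

/-- Quantum relative entropy `D(ρ‖σ) = Re Tr[ρ (log ρ − log σ)]`. -/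
noncomputable def qRelEnt {n : Type*} [Fintype n] [DecidableEq n]
    (ρ σ : Matrix n n ℂ) : ℝ :=
  (Matrix.trace (ρ * (matLog ρ - matLog σ))).re

/-- Centered observable `Q − Re Tr(ρQ)·I`. -/
noncomputable def centered {n : Type*} [Fintype n] [DecidableEq n]
    (ρ Q : Matrix n n ℂ) : Matrix n n ℂ :=
  Q - (((Matrix.trace (ρ * Q)).re : ℝ) : ℂ) • 1

/-- Symmetrized covariance matrix
`V_{uv} = (1/2)·Re Tr[ρ {Q_u − ⟨Q_u⟩, Q_v − ⟨Q_v⟩}]` of the charges `Q` in state `ρ`. -/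
noncomputable def covMatrix {n : Type*} [Fintype n] [DecidableEq n] {m : ℕ}
    (ρ : Matrix n n ℂ) (Q : Fin m → Matrix n n ℂ) : Matrix (Fin m) (Fin m) ℝ :=
  Matrix.of fun u v =>
    (1 / 2) * (Matrix.trace (ρ * (centered ρ (Q u) * centered ρ (Q v) +
      centered ρ (Q v) * centered ρ (Q u)))).re


/-- `F(s) := ∫₀¹ λ s / (1 + λ(1−λ) s) dλ`. -/
noncomputable def Fbound (s : ℝ) : ℝ :=
  ∫ lam in (0:ℝ)..1, lam * s / (1 + lam * (1 - lam) * s)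

/-- The matrix with orthonormal eigenvectors the columns of `U` and eigenvalues `f`. -/
noncomputable def spectralMatrix {n : Type*} [Fintype n] [DecidableEq n]
    (U : Matrix n n ℂ) (f : n → ℝ) : Matrix n n ℂ :=
  U * Matrix.diagonal (fun i => (f i : ℂ)) * star U

section SpectralMatrix

variable {n : Type*} [Fintype n] [DecidableEq n]

lemma spectralMatrix_one {U : Matrix n n ℂ} (hU : U * star U = 1) :
    spectralMatrix U (fun _ => 1) = 1 := by
  simp [spectralMatrix, hU]

lemma spectralMatrix_mul {U : Matrix n n ℂ} (hU : star U * U = 1) (f g : n → ℝ) :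
    spectralMatrix U f * spectralMatrix U g = spectralMatrix U (fun i => f i * g i) := by
  have h : spectralMatrix U f * spectralMatrix U g =
      U * Matrix.diagonal (fun i => (f i : ℂ)) * (star U * U) *
        Matrix.diagonal (fun i => (g i : ℂ)) * star U := by
    simp only [spectralMatrix, Matrix.mul_assoc]
  rw [h, hU, Matrix.mul_one, Matrix.mul_assoc U, Matrix.diagonal_mul_diagonal]
  simp [spectralMatrix]

lemma trace_spectralMatrix_mul (U W X Y : Matrix n n ℂ) (f g : n → ℝ) :
    (spectralMatrix U f * X * spectralMatrix W g * Y).trace =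
      ∑ i, ∑ j, (f i : ℂ) * g j * ((star U * X * W) i j * (star W * Y * U) j i) := by
  have h : (spectralMatrix U f * X * spectralMatrix W g * Y).trace =
      ((Matrix.diagonal (fun i => (f i : ℂ)) * (star U * X * W)) *
        (Matrix.diagonal (fun i => (g i : ℂ)) * (star W * Y * U))).trace := by
    have h1 : spectralMatrix U f * X * spectralMatrix W g * Y =
        U * (Matrix.diagonal (fun i => (f i : ℂ)) * (star U * X * W) *
          (Matrix.diagonal (fun i => (g i : ℂ)) * (star W * Y))) := by
      simp only [spectralMatrix, Matrix.mul_assoc]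
    rw [h1, Matrix.trace_mul_comm]
    simp only [Matrix.mul_assoc]
  rw [h, Matrix.trace]
  refine Finset.sum_congr rfl fun i _ => ?_
  rw [Matrix.diag_apply, Matrix.mul_apply]
  refine Finset.sum_congr rfl fun j _ => ?_
  rw [Matrix.diagonal_mul, Matrix.diagonal_mul]
  ring

lemma re_trace_spectralMatrix_mul_self {X : Matrix n n ℂ} (hX : X.IsHermitian)
    (U W : Matrix n n ℂ) (f g : n → ℝ) :
    (spectralMatrix U f * X * spectralMatrix W g * X).trace.re =
      ∑ i, ∑ j, f i * g j * Complex.normSq ((star U * X * W) i j) := by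
  rw [trace_spectralMatrix_mul, Complex.re_sum]
  refine Finset.sum_congr rfl fun i _ => ?_
  rw [Complex.re_sum]
  refine Finset.sum_congr rfl fun j _ => ?_
  have h : (star W * X * U) j i = star ((star U * X * W) i j) := by
    have h1 : star W * X * U = star (star U * X * W) := by
      rw [star_mul, star_mul, star_star, Matrix.star_eq_conjTranspose X, hX.eq, Matrix.mul_assoc]
    rw [h1, Matrix.star_apply]
  rw [h, Complex.star_def, Complex.mul_conj, ← Complex.ofReal_mul, ← Complex.ofReal_mul,
    Complex.ofReal_re]

lemma matLog_eq_spectralMatrix {A : Matrix n n ℂ} (hA : A.IsHermitian) :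
    matLog A = spectralMatrix (hA.eigenvectorUnitary : Matrix n n ℂ)
      (fun i => Real.log (hA.eigenvalues i)) := by
  rw [matLog, dif_pos hA, spectralMatrix]

lemma eq_spectralMatrix_eigenvalues {A : Matrix n n ℂ} (hA : A.IsHermitian) :
    A = spectralMatrix (hA.eigenvectorUnitary : Matrix n n ℂ) hA.eigenvalues := by
  conv_lhs => rw [hA.spectral_theorem]
  rw [Unitary.conjStarAlgAut_apply]
  rfl

end SpectralMatrix

lemma mixture_pos {a b t : ℝ} (ha : 0 < a) (hb : 0 < b) (ht : t ∈ Set.Icc (0:ℝ) 1) :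
    0 < t * b + (1 - t) * a := by
  nlinarith [lt_min ha hb, mul_nonneg ht.1 (sub_nonneg.2 (min_le_right a b)),
    mul_nonneg (sub_nonneg.2 ht.2) (sub_nonneg.2 (min_le_left a b))]

lemma integral_mul_sq_sub_div {a b : ℝ} (ha : 0 < a) (hb : 0 < b) :
    ∫ t in (0:ℝ)..1, t * ((a - b) ^ 2 / (t * b + (1 - t) * a)) =
      a * (Real.log a - Real.log b) - a + b := by
  have hpos : ∀ t ∈ Set.uIcc (0:ℝ) 1, 0 < t * b + (1 - t) * a := by
    intro t ht
    rw [Set.uIcc_of_le zero_le_one] at ht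
    exact mixture_pos ha hb ht
  have hderiv : ∀ t ∈ Set.uIcc (0:ℝ) 1,
      HasDerivAt (fun t => (t * b + (1 - t) * a) - a * Real.log (t * b + (1 - t) * a))
        (t * ((a - b) ^ 2 / (t * b + (1 - t) * a))) t := by
    intro t ht
    have hu : HasDerivAt (fun t : ℝ => t * b + (1 - t) * a) (1 * b + (-1) * a) t :=
      ((hasDerivAt_id t).mul_const b).add (((hasDerivAt_id t).const_sub 1).mul_const a)
    have hne := (hpos t ht).ne'
    refine (hu.sub ((hu.log hne).const_mul a)).congr_deriv ?_
    rw [← mul_div_assoc, ← mul_div_assoc, sub_eq_iff_eq_add, ← add_div, eq_div_iff hne]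
    ring
  rw [intervalIntegral.integral_eq_sub_of_hasDerivAt hderiv]
  · simp
    ring
  · refine ContinuousOn.intervalIntegrable ?_
    exact continuousOn_id.mul (continuousOn_const.div (by fun_prop) fun t ht => (hpos t ht).ne')

lemma re_trace_mul_sub_smul_one_sq {n : Type*} [Fintype n] [DecidableEq n]
    {τ : Matrix n n ℂ} (hτ : τ.trace = 1) (X : Matrix n n ℂ) (μ : ℝ) :
    (τ * ((X - (μ : ℂ) • 1) * (X - (μ : ℂ) • 1))).trace.re =
      (τ * (X * X)).trace.re - 2 * μ * (τ * X).trace.re + μ ^ 2 := by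
  have h : τ * ((X - (μ : ℂ) • 1) * (X - (μ : ℂ) • 1)) =
      τ * (X * X) - (2 * μ : ℂ) • (τ * X) + ((μ : ℂ) ^ 2) • τ := by
    simp only [sub_mul, mul_sub, smul_mul_assoc, mul_smul_comm, one_mul, mul_one]
    module
  rw [h, Matrix.trace_add, Matrix.trace_sub, Matrix.trace_smul, Matrix.trace_smul, hτ]
  simp [← Complex.ofReal_pow]

lemma dotProduct_covMatrix_mulVec {n : Type*} [Fintype n] [DecidableEq n] {m : ℕ}
    {τ : Matrix n n ℂ} (hτ : τ.trace = 1) (Q : Fin m → Matrix n n ℂ) (w : Fin m → ℝ) :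
    w ⬝ᵥ (covMatrix τ Q).mulVec w =
      (τ * ((∑ u, (w u : ℂ) • Q u) * (∑ u, (w u : ℂ) • Q u))).trace.re -
        (τ * ∑ u, (w u : ℂ) • Q u).trace.re ^ 2 := by
  set X := ∑ u, (w u : ℂ) • Q u with hX
  have hcent : X - ((τ * X).trace.re : ℂ) • 1 = ∑ u, (w u : ℂ) • centered τ (Q u) := by
    have hmean : (τ * X).trace.re = ∑ u, w u * (τ * Q u).trace.re := by
      simp [hX, Matrix.mul_sum, Matrix.trace_sum, Complex.re_sum]
    rw [hmean, hX]
    simp only [centered, smul_sub, Finset.sum_sub_distrib, smul_smul, Complex.ofReal_sum,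
      Complex.ofReal_mul, Finset.sum_smul]
  have hvar := re_trace_mul_sub_smul_one_sq hτ X (τ * X).trace.re
  have hsum : (τ * ((X - ((τ * X).trace.re : ℂ) • 1) *
      (X - ((τ * X).trace.re : ℂ) • 1))).trace.re =
        ∑ u, ∑ v, w u * w v * (τ * (centered τ (Q u) * centered τ (Q v))).trace.re := by
    rw [hcent, Finset.sum_mul_sum]
    simp only [Matrix.mul_sum, Matrix.trace_sum, Complex.re_sum, smul_mul_assoc, mul_smul_comm,
      smul_smul, Matrix.trace_smul]
    refine Finset.sum_congr rfl fun u _ => Finset.sum_congr rfl fun v _ => ?_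
    rw [← Complex.ofReal_mul, smul_eq_mul, Complex.re_ofReal_mul, mul_comm (w v)]
  have hcov : w ⬝ᵥ (covMatrix τ Q).mulVec w =
      ∑ u, ∑ v, w u * w v * (τ * (centered τ (Q u) * centered τ (Q v))).trace.re := by
    set g : Fin m → Fin m → ℝ :=
      fun u v => w u * w v * (τ * (centered τ (Q u) * centered τ (Q v))).trace.re with hg
    have h1 : w ⬝ᵥ (covMatrix τ Q).mulVec w = ∑ u, ∑ v, (1 / 2) * (g u v + g v u) := by
      simp only [dotProduct, Matrix.mulVec, Finset.mul_sum, covMatrix, Matrix.of_apply, hg,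
        mul_add, Matrix.trace_add, Complex.add_re]
      refine Finset.sum_congr rfl fun u _ => Finset.sum_congr rfl fun v _ => ?_
      ring
    rw [h1]
    simp only [← Finset.mul_sum, Finset.sum_add_distrib]
    rw [Finset.sum_comm (f := fun u v => g v u)]
    ring
  rw [hcov, ← hsum, hvar]
  ring

section SpectralDivergence

variable {n : Type*} [Fintype n] [DecidableEq n]

lemma sum_sum_mul_normSq_overlap (U W : Matrix n n ℂ) (f g : n → ℝ) :
    ∑ i, ∑ j, f i * g j * Complex.normSq ((star U * W) i j) =
      (spectralMatrix U f * spectralMatrix W g).trace.re := by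
  have h := re_trace_spectralMatrix_mul_self (Matrix.isHermitian_one (n := n) (α := ℂ)) U W f g
  simpa using h.symm

lemma spectralMatrix_relEnt_eq_integral {U W : Matrix n n ℂ}
    (hU : star U * U = 1) (hW : star W * W = 1) {a b : n → ℝ}
    (ha : ∀ i, 0 < a i) (hb : ∀ j, 0 < b j)
    (htr : (spectralMatrix U a).trace = (spectralMatrix W b).trace) :
    (spectralMatrix U a * (spectralMatrix U (fun i => Real.log (a i)) -
      spectralMatrix W (fun j => Real.log (b j)))).trace.re =
    ∫ t in (0:ℝ)..1, t * ∑ i, ∑ j, (a i - b j) ^ 2 / (t * b j + (1 - t) * a i) *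
      Complex.normSq ((star U * W) i j) := by
  have hU' : U * star U = 1 := mul_eq_one_comm.1 hU
  have hW' : W * star W = 1 := mul_eq_one_comm.1 hW
  have hcont : ∀ i j, IntervalIntegrable
      (fun t : ℝ => t * ((a i - b j) ^ 2 / (t * b j + (1 - t) * a i))) volume 0 1 := by
    intro i j
    refine ContinuousOn.intervalIntegrable ?_
    refine continuousOn_id.mul (continuousOn_const.div (by fun_prop) fun t ht => ?_)
    rw [Set.uIcc_of_le zero_le_one] at ht
    exact (mixture_pos (ha i) (hb j) ht).ne'
  have hint : (∫ t in (0:ℝ)..1, t * ∑ i, ∑ j, (a i - b j) ^ 2 / (t * b j + (1 - t) * a i) *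
      Complex.normSq ((star U * W) i j)) =
      ∑ i, ∑ j, (a i * (Real.log (a i) - Real.log (b j)) - a i + b j) *
        Complex.normSq ((star U * W) i j) := by
    simp only [Finset.mul_sum, ← mul_assoc]
    rw [intervalIntegral.integral_finsetSum]
    · refine Finset.sum_congr rfl fun i _ => ?_
      rw [intervalIntegral.integral_finsetSum]
      · refine Finset.sum_congr rfl fun j _ => ?_
        rw [intervalIntegral.integral_mul_const, integral_mul_sq_sub_div (ha i) (hb j)]
      · exact fun j _ => (hcont i j).mul_const _
    · intro i _
      simpa only [Finset.sum_fn] using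
        IntervalIntegrable.sum Finset.univ fun j _ =>
          (hcont i j).mul_const (Complex.normSq ((star U * W) i j))
  have hsplit : ∑ i, ∑ j, (a i * (Real.log (a i) - Real.log (b j)) - a i + b j) *
        Complex.normSq ((star U * W) i j) =
      ∑ i, ∑ j, (a i * Real.log (a i)) * 1 * Complex.normSq ((star U * W) i j) -
      ∑ i, ∑ j, a i * Real.log (b j) * Complex.normSq ((star U * W) i j) -
      ∑ i, ∑ j, a i * 1 * Complex.normSq ((star U * W) i j) +
      ∑ i, ∑ j, 1 * b j * Complex.normSq ((star U * W) i j) := by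
    simp only [← Finset.sum_sub_distrib, ← Finset.sum_add_distrib]
    refine Finset.sum_congr rfl fun i _ => Finset.sum_congr rfl fun j _ => ?_
    ring
  rw [hint, hsplit, sum_sum_mul_normSq_overlap U W (fun i => a i * Real.log (a i)) (fun _ => 1),
    sum_sum_mul_normSq_overlap U W a (fun j => Real.log (b j)),
    sum_sum_mul_normSq_overlap U W a (fun _ => 1), sum_sum_mul_normSq_overlap U W (fun _ => 1) b,
    spectralMatrix_one hU', spectralMatrix_one hW', mul_one, mul_one, one_mul, htr, mul_sub,
    spectralMatrix_mul hU, Matrix.trace_sub, Complex.sub_re]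
  ring

lemma sq_re_trace_sub_mul_le {U W X : Matrix n n ℂ}
    (hU : star U * U = 1) (hW : star W * W = 1) (hX : X.IsHermitian) {a b : n → ℝ}
    (ha : ∀ i, 0 < a i) (hb : ∀ j, 0 < b j) {t : ℝ} (ht : t ∈ Set.Icc (0:ℝ) 1) :
    ((spectralMatrix U a - spectralMatrix W b) * X).trace.re ^ 2 ≤
      (∑ i, ∑ j, (a i - b j) ^ 2 / (t * b j + (1 - t) * a i) *
        Complex.normSq ((star U * W) i j)) *
      (t * (spectralMatrix W b * (X * X)).trace.re +
        (1 - t) * (spectralMatrix U a * (X * X)).trace.re) := by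
  have hU' : U * star U = 1 := mul_eq_one_comm.1 hU
  have hW' : W * star W = 1 := mul_eq_one_comm.1 hW
  have hone : ∀ i j, (star W * (1 : Matrix n n ℂ) * U) j i = star ((star U * W) i j) := by
    intro i j
    rw [← Matrix.star_apply, star_mul, star_star, mul_one]
  have hmean : ((spectralMatrix U a - spectralMatrix W b) * X).trace.re =
      ∑ i, ∑ j, (a i - b j) * ((star U * X * W) i j * star ((star U * W) i j)).re := by
    have h1 := congrArg Complex.re (trace_spectralMatrix_mul U W X 1 a (fun _ => 1))
    have h2 := congrArg Complex.re (trace_spectralMatrix_mul U W X 1 (fun _ => 1) b)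
    rw [spectralMatrix_one hW', mul_one, mul_one] at h1
    rw [spectralMatrix_one hU', mul_one, one_mul, Matrix.trace_mul_comm] at h2
    rw [sub_mul, Matrix.trace_sub, Complex.sub_re, h1, h2, Complex.re_sum, Complex.re_sum,
      ← Finset.sum_sub_distrib]
    refine Finset.sum_congr rfl fun i _ => ?_
    rw [Complex.re_sum, Complex.re_sum, ← Finset.sum_sub_distrib]
    refine Finset.sum_congr rfl fun j _ => ?_
    rw [hone, ← Complex.ofReal_mul, ← Complex.ofReal_mul, Complex.re_ofReal_mul,
      Complex.re_ofReal_mul]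
    ring
  have hsecond : t * (spectralMatrix W b * (X * X)).trace.re +
        (1 - t) * (spectralMatrix U a * (X * X)).trace.re =
      ∑ i, ∑ j, (t * b j + (1 - t) * a i) * Complex.normSq ((star U * X * W) i j) := by
    have h1 := re_trace_spectralMatrix_mul_self hX U W a (fun _ => 1)
    have h2 := re_trace_spectralMatrix_mul_self hX U W (fun _ => 1) b
    rw [spectralMatrix_one hW', mul_one, mul_assoc] at h1
    rw [spectralMatrix_one hU', one_mul, Matrix.trace_mul_comm, ← mul_assoc,
      Matrix.trace_mul_comm] at h2
    rw [h1, h2, Finset.mul_sum, Finset.mul_sum, ← Finset.sum_add_distrib]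
    refine Finset.sum_congr rfl fun i _ => ?_
    rw [Finset.mul_sum, Finset.mul_sum, ← Finset.sum_add_distrib]
    refine Finset.sum_congr rfl fun j _ => ?_
    ring
  rw [hmean, hsecond]
  simp only [← Fintype.sum_prod_type']
  refine Finset.sum_sq_le_sum_mul_sum_of_sq_le_mul _ (fun p _ => ?_) (fun p _ => ?_) fun p _ => ?_
  · exact mul_nonneg (div_nonneg (sq_nonneg _) (mixture_pos (ha _) (hb _) ht).le)
      (Complex.normSq_nonneg _)
  · exact mul_nonneg (mixture_pos (ha _) (hb _) ht).le (Complex.normSq_nonneg _)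
  · obtain ⟨i, j⟩ := p
    have hm := (mixture_pos (ha i) (hb j) ht).ne'
    have hcs : ((star U * X * W) i j * star ((star U * W) i j)).re ^ 2 ≤
        Complex.normSq ((star U * X * W) i j) * Complex.normSq ((star U * W) i j) := by
      rw [← Complex.normSq_conj ((star U * W) i j), ← Complex.normSq_mul, sq]
      exact Complex.re_sq_le_normSq _
    calc ((a i - b j) * ((star U * X * W) i j * star ((star U * W) i j)).re) ^ 2
        = (a i - b j) ^ 2 * ((star U * X * W) i j * star ((star U * W) i j)).re ^ 2 := by ring
      _ ≤ (a i - b j) ^ 2 * (Complex.normSq ((star U * X * W) i j) *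
            Complex.normSq ((star U * W) i j)) := by gcongr
      _ = _ := by
        rw [mul_mul_mul_comm, div_mul_cancel₀ _ hm]
        ring

end SpectralDivergence

lemma div_one_add_le_of_sq_le_mul {s r K : ℝ} (hs : 0 ≤ s) (hr : 0 ≤ r) (hK : 0 ≤ K)
    (h : s ^ 2 ≤ K * (s + r * s ^ 2)) : s / (1 + r * s) ≤ K := by
  rcases hs.eq_or_lt with rfl | hs
  · simpa using hK
  · rw [div_le_iff₀ (by positivity)]
    refine le_of_mul_le_mul_left ?_ hs
    linarith

/-- Symmetric-covariance TUR: if `V' = V` is positive definite and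
`s = Δqᵀ V⁻¹ Δq`, then `D(ρ'‖ρ) ≥ F(s)`. -/
theorem symmetric_covariance_TUR
    (d m : ℕ) (hd : 0 < d) (hm : 0 < m)
    (ρ' ρ : Matrix (Fin d) (Fin d) ℂ)
    (hρ' : ρ'.PosDef) (hρ : ρ.PosDef)
    (hρ'tr : ρ'.trace = 1) (hρtr : ρ.trace = 1)
    (Q : Fin m → Matrix (Fin d) (Fin d) ℂ) (hQ : ∀ u, (Q u).IsHermitian)
    (Δq : Fin m → ℝ)
    (hΔq : ∀ u, Δq u = (Matrix.trace ((ρ' - ρ) * Q u)).re)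
    (V V' : Matrix (Fin m) (Fin m) ℝ)
    (hV : V = covMatrix ρ Q) (hV' : V' = covMatrix ρ' Q)
    (hsym : V' = V) (hVpd : V.PosDef)
    (s : ℝ) (hs : s = Δq ⬝ᵥ (V⁻¹).mulVec Δq) :
    qRelEnt ρ' ρ ≥ Fbound s := by
  have hpos' := hρ'.eigenvalues_pos
  have hpos := hρ.eigenvalues_pos
  set a := hρ'.isHermitian.eigenvalues
  set b := hρ.isHermitian.eigenvalues
  set U : Matrix (Fin d) (Fin d) ℂ :=
    (hρ'.isHermitian.eigenvectorUnitary : Matrix (Fin d) (Fin d) ℂ)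
  set W : Matrix (Fin d) (Fin d) ℂ :=
    (hρ.isHermitian.eigenvectorUnitary : Matrix (Fin d) (Fin d) ℂ)
  have hρ'U : ρ' = spectralMatrix U a := eq_spectralMatrix_eigenvalues hρ'.isHermitian
  have hρW : ρ = spectralMatrix W b := eq_spectralMatrix_eigenvalues hρ.isHermitian
  have hUU : star U * U = 1 := Unitary.coe_star_mul_self _
  have hWW : star W * W = 1 := Unitary.coe_star_mul_self _
  set K : ℝ → ℝ := fun t => ∑ i, ∑ j, (a i - b j) ^ 2 / (t * b j + (1 - t) * a i) *
      Complex.normSq ((star U * W) i j)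
  have hent : qRelEnt ρ' ρ = ∫ t in (0:ℝ)..1, t * K t := by
    rw [qRelEnt, matLog_eq_spectralMatrix hρ'.isHermitian, matLog_eq_spectralMatrix hρ.isHermitian,
      ← spectralMatrix_relEnt_eq_integral hUU hWW hpos' hpos
        (by rw [← hρ'U, ← hρW, hρ'tr, hρtr]), ← hρ'U]
  set w : Fin m → ℝ := V⁻¹.mulVec Δq with hw
  set X : Matrix (Fin d) (Fin d) ℂ := ∑ u, (w u : ℂ) • Q u with hXdef
  have hX : X.IsHermitian := by
    simp only [hXdef, Matrix.IsHermitian, Matrix.conjTranspose_sum, Matrix.conjTranspose_smul,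
      (hQ _).eq, Complex.star_def, Complex.conj_ofReal]
  have hVw : V.mulVec w = Δq := by
    rw [hw, Matrix.mulVec_mulVec, Matrix.mul_nonsing_inv _ hVpd.det_pos.ne'.isUnit,
      Matrix.one_mulVec]
  have hvarw : w ⬝ᵥ V.mulVec w = s := by rw [hVw, hs, dotProduct_comm]
  have hs0 : 0 ≤ s := by
    rw [← hvarw]
    simpa using hVpd.posSemidef.dotProduct_mulVec_nonneg w
  have hvar : (ρ * (X * X)).trace.re = s + (ρ * X).trace.re ^ 2 := by
    have h := dotProduct_covMatrix_mulVec hρtr Q w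
    rw [← hV, hvarw] at h
    linarith
  have hvar' : (ρ' * (X * X)).trace.re = s + (ρ' * X).trace.re ^ 2 := by
    have h := dotProduct_covMatrix_mulVec hρ'tr Q w
    rw [← hV', hsym, hvarw] at h
    linarith
  have hmean : (ρ' * X).trace.re - (ρ * X).trace.re = s := by
    rw [← Complex.sub_re, ← Matrix.trace_sub, ← sub_mul, hs, dotProduct_comm, hXdef]
    simp [Matrix.mul_sum, Matrix.trace_sum, dotProduct, hΔq]
  have hle : ∀ t ∈ Set.Icc (0:ℝ) 1, t * s / (1 + t * (1 - t) * s) ≤ t * K t := by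
    intro t ht
    rw [mul_div_assoc]
    refine mul_le_mul_of_nonneg_left (div_one_add_le_of_sq_le_mul hs0
      (mul_nonneg ht.1 (sub_nonneg.2 ht.2)) ?_ ?_) ht.1
    · exact Finset.sum_nonneg fun i _ => Finset.sum_nonneg fun j _ =>
        mul_nonneg (div_nonneg (sq_nonneg _) (mixture_pos (hpos' i) (hpos j) ht).le)
          (Complex.normSq_nonneg _)
    · set μ : ℝ := t * (ρ * X).trace.re + (1 - t) * (ρ' * X).trace.re with hμ
      have hXμ : (X - (μ : ℂ) • 1).IsHermitian := by
        simp [Matrix.IsHermitian, hX.eq]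
      have h := sq_re_trace_sub_mul_le hUU hWW hXμ hpos' hpos ht
      rw [← hρ'U, ← hρW, re_trace_mul_sub_smul_one_sq hρtr, re_trace_mul_sub_smul_one_sq hρ'tr,
        hvar, hvar'] at h
      have hshift : ((ρ' - ρ) * (X - (μ : ℂ) • 1)).trace.re = s := by
        simp [mul_sub, sub_mul, hρ'tr, hρtr, ← hmean]
      rw [hshift] at h
      refine h.trans_eq (congrArg (K t * ·) ?_)
      rw [hμ, ← hmean]
      ring
  rw [ge_iff_le, hent, Fbound]
  refine intervalIntegral.integral_mono_on zero_le_one ?_ ?_ hle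
  · refine ContinuousOn.intervalIntegrable (ContinuousOn.div (by fun_prop) (by fun_prop) ?_)
    intro t ht
    rw [Set.uIcc_of_le zero_le_one] at ht
    have := mul_nonneg (mul_nonneg ht.1 (sub_nonneg.2 ht.2)) hs0
    positivity
  · refine ContinuousOn.intervalIntegrable (continuousOn_id.mul ?_)
    refine continuousOn_finsetSum _ fun i _ => continuousOn_finsetSum _ fun j _ => ?_
    refine (continuousOn_const.div (by fun_prop) fun t ht => ?_).mul continuousOn_const
    rw [Set.uIcc_of_le zero_le_one] at ht
    exact (mixture_pos (hpos' i) (hpos j) ht).ne'
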